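/- Let D ⊆ ℝ² be open and simply connected with coordinates (u,v), and equip ℝ³ with the Minkowski inner product ⟨x,y⟩ = −x₁y₁ + x₂y₂ + x₃y₃. Let F, N : D → ℝ³ and ω : D → ℝ be smooth with ⟨F_u,F_u⟩ = ⟨F_v,F_v⟩ = 0, ⟨F_u,F_v⟩ = e^ω/2, ⟨N,N⟩ = 1, ⟨F_u,N⟩ = ⟨F_v,N⟩ = 0. Let ε ∈ {−1,1}, let ϱ : ℝ → ℝ and σ : ℝ → ℝ be smooth and positive, and let q : D → ℝ be smooth with ⟨F_uu,N⟩ = (1/2) q(u,v) ϱ(u) and ⟨F_vv,N⟩ = ε (1/2) q(u,v) σ(v) on D. Set H := 2e^{−ω}⟨F_uv,N⟩. Then: (i) ∂_v(e^{−ω} ϱ(u) F_v) = ε ∂_u(e^{−ω} σ(v) F_u) on D, so there exists a smooth F* : D → ℝ³ with F*_u = e^{−ω} ϱ F_v and F*_v = ε e^{−ω} σ F_u; (ii) ⟨F*_u,F*_u⟩ = ⟨F*_v,F*_v⟩ = 0 and ⟨F*_u,F*_v⟩ = ε e^{−ω} ϱ σ/2; (iii) ⟨F*_uu,N⟩ =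 ϱ(u) H/2, ⟨F*_vv,N⟩ = ε σ(v) H/2, and ⟨F*_uv,N⟩ = (ε/2) q e^{−ω} ϱ σ. -/

import Mathlib

noncomputable section

/-- The Minkowski inner product on `ℝ³`: `⟨x,y⟩ = −x₁y₁ + x₂y₂ + x₃y₃`. -/
def mink (x y : Fin 3 → ℝ) : ℝ := -(x 0 * y 0) + x 1 * y 1 + x 2 * y 2

/-- Partial derivative in the first variable of an `ℝ³`-valued map. -/
def pdv1 (F : ℝ → ℝ → Fin 3 → ℝ) (u v : ℝ) : Fin 3 → ℝ :=
  fun i => deriv (fun x => F x v i) u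

/-- Partial derivative in the second variable of an `ℝ³`-valued map. -/
def pdv2 (F : ℝ → ℝ → Fin 3 → ℝ) (u v : ℝ) : Fin 3 → ℝ :=
  fun i => deriv (fun y => F u y i) v

/-- Partial derivative in the first variable of a scalar two-variable function. -/
def pd1 (f : ℝ → ℝ → ℝ) (u v : ℝ) : ℝ := deriv (fun x => f x v) u

/-- Partial derivative in the second variable of a scalar two-variable function. -/
def pd2 (f : ℝ → ℝ → ℝ) (u v : ℝ) : ℝ := deriv (fun y => f u y) v

/-- Smoothness of a two-variable map on a set. -/
def Smooth2 {E : Type*} [NormedAddCommGroup E] [NormedSpace ℝ E]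
    (f : ℝ → ℝ → E) (s : Set (ℝ × ℝ)) : Prop :=
  ContDiffOn ℝ (⊤ : ℕ∞) (fun p : ℝ × ℝ => f p.1 p.2) s

open Topology in
/-- On a simply connected, locally path-connected space, local functions whose differences are
constant on overlaps glue, up to locally constant functions. -/
theorem exists_glue_of_sub_const {X G : Type*} [TopologicalSpace X] [SimplyConnectedSpace X]
    [LocallyPathConnectedSpace X] [AddCommGroup G] (U : X → Set X) (hU : ∀ i, IsOpen (U i))
    (hmem : ∀ i, i ∈ U i) (f : X → X → G)
    (hf : ∀ i j, ∃ c, ∀ x ∈ U i ∩ U j, f i x - f j x = c) :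
    ∃ P : X → G, ∀ i, ∃ c, ∀ᶠ y in 𝓝 i, P y = f i y + c := by
  let _ : TopologicalSpace G := ⊥
  have : DiscreteTopology G := ⟨rfl⟩
  let Z : FiberBundleCore X X G :=
    { baseSet := U
      isOpen_baseSet := hU
      indexAt := id
      mem_baseSet_at := hmem
      coordChange := fun i j x v => v + (f i x - f j x)
      coordChange_self := fun i x _ v => by simp
      continuousOn_coordChange := fun i j => by
        obtain ⟨c, hc⟩ := hf i j
        refine ContinuousOn.congr (f := fun p : X × G => p.2 + c) ?_ ?_
        · exact (continuous_of_discreteTopology (f := fun v : G => v + c)).comp_continuousOn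
            continuousOn_snd
        · rintro ⟨x, v⟩ hx
          simp only [hc x hx.1]
      coordChange_comp := fun i j k x _ v => by abel }
  obtain ⟨x₀⟩ : Nonempty X := inferInstance
  obtain ⟨s, ⟨-, hs⟩, -⟩ :=
    (FiberBundle.isCoveringMap (F := G) (E := Z.Fiber)).existsUnique_continuousMap_lifts
      (ContinuousMap.id X) x₀ ⟨x₀, (0 : G)⟩ rfl
  have hs' : ∀ x, (s x).1 = x := fun x => congrFun hs x
  refine ⟨fun x => (show G from (s x).2) + f x x, fun i => ?_⟩
  have hcont : ContinuousAt (fun y => (Z.localTriv i (s y)).2) i := by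
    refine continuous_snd.continuousAt.comp
      (ContinuousAt.comp (g := Z.localTriv i) ?_ s.continuous.continuousAt)
    apply (Z.localTriv i).continuousAt
    rw [FiberBundleCore.mem_localTriv_source, hs']
    exact hmem i
  refine ⟨(Z.localTriv i (s i)).2, ?_⟩
  have := hcont.eventually (show ∀ᶠ z in 𝓝 ((Z.localTriv i (s i)).2), z = (Z.localTriv i (s i)).2 by
    rw [nhds_discrete]; simp)
  filter_upwards [this] with y hy
  rw [← hy, FiberBundleCore.localTriv_apply]
  change _ = f i y + ((show G from (s y).2) + (f (s y).1 (s y).1 - f i (s y).1))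
  rw [hs']
  abel

open Topology in
/-- **Poincaré lemma** for `1`-forms on a simply connected open set. -/
theorem IsOpen.exists_hasFDerivAt_of_fderiv_symmetric {E G : Type*} [NormedAddCommGroup E]
    [NormedSpace ℝ E] [NormedAddCommGroup G] [NormedSpace ℝ G] [CompleteSpace G]
    {s : Set E} (hs : IsOpen s) (hsc : SimplyConnectedSpace s) {η : E → E →L[ℝ] G}
    (hη : DifferentiableOn ℝ η s)
    (hdη : ∀ a ∈ s, ∀ x y, fderiv ℝ η a x y = fderiv ℝ η a y x) :
    ∃ P : E → G, ∀ a ∈ s, HasFDerivAt P (η a) a := by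
  have := hs.locallyPathConnectedSpace
  have hloc : ∀ i : s, ∃ r > 0, Metric.ball (i : E) r ⊆ s := fun i =>
    Metric.isOpen_iff.1 hs i i.2
  choose r hr hrs using hloc
  have hprim : ∀ i : s, ∃ f : E → G, ∀ a ∈ Metric.ball (i : E) (r i), HasFDerivAt f (η a) a :=
    fun i => (convex_ball _ _).exists_forall_hasFDerivAt_of_fderiv_symmetric Metric.isOpen_ball
      (hη.mono (hrs i)) fun a ha => hdη a (hrs i ha)
  choose f hf using hprim
  obtain ⟨P, hP⟩ := exists_glue_of_sub_const
    (fun i : s => Subtype.val ⁻¹' Metric.ball (i : E) (r i))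
    (fun i => Metric.isOpen_ball.preimage continuous_subtype_val)
    (fun i => Metric.mem_ball_self (hr i)) (fun i x => f i x) (fun i j => by
      obtain ⟨c, hc⟩ := IsOpen.exists_is_const_of_fderiv_eq_zero
        (Metric.isOpen_ball.inter Metric.isOpen_ball) (𝕜 := ℝ)
        (s := Metric.ball (i : E) (r i) ∩ Metric.ball (j : E) (r j))
        (f := fun x => f i x - f j x)
        ((convex_ball _ _).inter (convex_ball _ _)).isPreconnected
        (fun x hx => ((hf i x hx.1).sub (hf j x hx.2)).differentiableAt.differentiableWithinAt)
        (fun x hx => ((hf i x hx.1).sub (hf j x hx.2)).fderiv.trans (sub_self _))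
      exact ⟨c, fun x hx => hc x hx⟩)
  classical
  refine ⟨fun x => if h : x ∈ s then P ⟨x, h⟩ else 0, fun a ha => ?_⟩
  obtain ⟨c, hc⟩ := hP ⟨a, ha⟩
  refine ((hf ⟨a, ha⟩ a (Metric.mem_ball_self (hr _))).add_const c).congr_of_eventuallyEq ?_
  rw [nhds_subtype, Filter.eventually_comap] at hc
  filter_upwards [hc, hs.mem_nhds ha] with y hy hys
  simp only [hys, dif_pos]
  exact hy ⟨y, hys⟩ rfl

section Partials

variable {D : Set (ℝ × ℝ)} {u v : ℝ}

theorem Smooth2.differentiableAt {E : Type*} [NormedAddCommGroup E] [NormedSpace ℝ E]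
    {f : ℝ → ℝ → E} (hf : Smooth2 f D) (hD : IsOpen D) (h : (u, v) ∈ D) :
    DifferentiableAt ℝ (fun p : ℝ × ℝ => f p.1 p.2) (u, v) :=
  (hf.contDiffAt (hD.mem_nhds h)).differentiableAt (by simp)

theorem Smooth2.hasDerivAt_fst {E : Type*} [NormedAddCommGroup E] [NormedSpace ℝ E]
    {f : ℝ → ℝ → E} (hf : Smooth2 f D) (hD : IsOpen D) (h : (u, v) ∈ D) :
    HasDerivAt (fun x => f x v) (fderiv ℝ (fun p : ℝ × ℝ => f p.1 p.2) (u, v) (1, 0)) u :=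
  HasFDerivAt.comp_hasDerivAt (f := fun x : ℝ => (x, v)) u
    (hf.differentiableAt hD h).hasFDerivAt ((hasDerivAt_id u).prodMk (hasDerivAt_const u v))

theorem Smooth2.hasDerivAt_snd {E : Type*} [NormedAddCommGroup E] [NormedSpace ℝ E]
    {f : ℝ → ℝ → E} (hf : Smooth2 f D) (hD : IsOpen D) (h : (u, v) ∈ D) :
    HasDerivAt (fun y => f u y) (fderiv ℝ (fun p : ℝ × ℝ => f p.1 p.2) (u, v) (0, 1)) v :=
  (hf.differentiableAt hD h).hasFDerivAt.comp_hasDerivAt v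
    ((hasDerivAt_const v u).prodMk (hasDerivAt_id v))

theorem pdv1_eq_of_hasDerivAt {F : ℝ → ℝ → Fin 3 → ℝ} {w : Fin 3 → ℝ}
    (h : HasDerivAt (fun x => F x v) w u) : pdv1 F u v = w :=
  funext fun i => (hasDerivAt_pi.1 h i).deriv

theorem pdv2_eq_of_hasDerivAt {F : ℝ → ℝ → Fin 3 → ℝ} {w : Fin 3 → ℝ}
    (h : HasDerivAt (fun y => F u y) w v) : pdv2 F u v = w :=
  funext fun i => (hasDerivAt_pi.1 h i).deriv

variable {F : ℝ → ℝ → Fin 3 → ℝ}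

theorem Smooth2.pdv1_eq_fderiv (hF : Smooth2 F D) (hD : IsOpen D) (h : (u, v) ∈ D) :
    pdv1 F u v = fderiv ℝ (fun p : ℝ × ℝ => F p.1 p.2) (u, v) (1, 0) :=
  pdv1_eq_of_hasDerivAt (hF.hasDerivAt_fst hD h)

theorem Smooth2.pdv2_eq_fderiv (hF : Smooth2 F D) (hD : IsOpen D) (h : (u, v) ∈ D) :
    pdv2 F u v = fderiv ℝ (fun p : ℝ × ℝ => F p.1 p.2) (u, v) (0, 1) :=
  pdv2_eq_of_hasDerivAt (hF.hasDerivAt_snd hD h)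

theorem Smooth2.hasDerivAt_pdv1 (hF : Smooth2 F D) (hD : IsOpen D) (h : (u, v) ∈ D) :
    HasDerivAt (fun x => F x v) (pdv1 F u v) u :=
  hF.pdv1_eq_fderiv hD h ▸ hF.hasDerivAt_fst hD h

theorem Smooth2.hasDerivAt_pdv2 (hF : Smooth2 F D) (hD : IsOpen D) (h : (u, v) ∈ D) :
    HasDerivAt (fun y => F u y) (pdv2 F u v) v :=
  hF.pdv2_eq_fderiv hD h ▸ hF.hasDerivAt_snd hD h

theorem Smooth2.contDiffOn_fderiv {E : Type*} [NormedAddCommGroup E] [NormedSpace ℝ E]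
    {f : ℝ → ℝ → E} (hf : Smooth2 f D) (hD : IsOpen D) :
    ContDiffOn ℝ (⊤ : ℕ∞) (fderiv ℝ (fun p : ℝ × ℝ => f p.1 p.2)) D :=
  ((contDiffOn_infty_iff_fderiv_of_isOpen hD).1 hf).2

theorem Smooth2.pdv1 (hF : Smooth2 F D) (hD : IsOpen D) : Smooth2 (pdv1 F) D :=
  ((hF.contDiffOn_fderiv hD).clm_apply contDiffOn_const).congr
    fun _ hp => hF.pdv1_eq_fderiv hD hp

theorem Smooth2.pdv2 (hF : Smooth2 F D) (hD : IsOpen D) : Smooth2 (pdv2 F) D :=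
  ((hF.contDiffOn_fderiv hD).clm_apply contDiffOn_const).congr
    fun _ hp => hF.pdv2_eq_fderiv hD hp

theorem eventually_fst_mem (hD : IsOpen D) (h : (u, v) ∈ D) :
    ∀ᶠ x in nhds u, (x, v) ∈ D :=
  (hD.preimage (by fun_prop : Continuous fun x : ℝ => (x, v))).mem_nhds h

theorem eventually_snd_mem (hD : IsOpen D) (h : (u, v) ∈ D) :
    ∀ᶠ y in nhds v, (u, y) ∈ D :=
  (hD.preimage (by fun_prop : Continuous fun y : ℝ => (u, y))).mem_nhds h

theorem pdv1_congr {G : ℝ → ℝ → Fin 3 → ℝ} (hD : IsOpen D)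
    (hFG : ∀ u v, (u, v) ∈ D → F u v = G u v) (h : (u, v) ∈ D) : pdv1 F u v = pdv1 G u v := by
  funext i
  refine Filter.EventuallyEq.deriv_eq ?_
  filter_upwards [eventually_fst_mem hD h] with x hx
  rw [hFG x v hx]

theorem pdv2_congr {G : ℝ → ℝ → Fin 3 → ℝ} (hD : IsOpen D)
    (hFG : ∀ u v, (u, v) ∈ D → F u v = G u v) (h : (u, v) ∈ D) : pdv2 F u v = pdv2 G u v := by
  funext i
  refine Filter.EventuallyEq.deriv_eq ?_
  filter_upwards [eventually_snd_mem hD h] with y hy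
  rw [hFG u y hy]

theorem Smooth2.pdv2_pdv1 (hF : Smooth2 F D) (hD : IsOpen D) (h : (u, v) ∈ D) :
    _root_.pdv2 (_root_.pdv1 F) u v = _root_.pdv1 (_root_.pdv2 F) u v := by
  have hd : DifferentiableAt ℝ (fderiv ℝ (fun p : ℝ × ℝ => F p.1 p.2)) (u, v) :=
    ((hF.contDiffOn_fderiv hD).contDiffAt (hD.mem_nhds h)).differentiableAt (by simp)
  have hsymm : IsSymmSndFDerivAt ℝ (fun p : ℝ × ℝ => F p.1 p.2) (u, v) :=
    (hF.contDiffAt (hD.mem_nhds h)).isSymmSndFDerivAt (by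
      rw [minSmoothness_of_isRCLikeNormedField]; exact WithTop.coe_le_coe.2 le_top)
  have h1 : _root_.pdv2 (_root_.pdv1 F) u v
      = fderiv ℝ (fderiv ℝ (fun p : ℝ × ℝ => F p.1 p.2)) (u, v) (0, 1) (1, 0) := by
    rw [pdv2_congr hD (fun u v h => hF.pdv1_eq_fderiv hD h) h]
    refine pdv2_eq_of_hasDerivAt ?_
    have := (hd.hasFDerivAt.clm_apply (hasFDerivAt_const ((1 : ℝ), (0 : ℝ)) _)).comp_hasDerivAt v
      ((hasDerivAt_const v u).prodMk (hasDerivAt_id v))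
    exact this.congr_deriv (by simp)
  have h2 : _root_.pdv1 (_root_.pdv2 F) u v
      = fderiv ℝ (fderiv ℝ (fun p : ℝ × ℝ => F p.1 p.2)) (u, v) (1, 0) (0, 1) := by
    rw [pdv1_congr hD (fun u v h => hF.pdv2_eq_fderiv hD h) h]
    refine pdv1_eq_of_hasDerivAt ?_
    have := (hd.hasFDerivAt.clm_apply (hasFDerivAt_const ((0 : ℝ), (1 : ℝ)) _)).comp_hasDerivAt u
      ((hasDerivAt_id u).prodMk (hasDerivAt_const u v))
    exact this.congr_deriv (by simp)
  rw [h1, h2]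
  exact hsymm _ _

/-- The Poincaré lemma in terms of partial derivatives. -/
theorem exists_smooth2_pdv_eq {A B : ℝ → ℝ → Fin 3 → ℝ} (hD : IsOpen D)
    (hsc : SimplyConnectedSpace D) (hA : Smooth2 A D) (hB : Smooth2 B D)
    (hAB : ∀ u v, (u, v) ∈ D → pdv2 A u v = pdv1 B u v) :
    ∃ P : ℝ → ℝ → Fin 3 → ℝ, Smooth2 P D ∧
      ∀ u v, (u, v) ∈ D → pdv1 P u v = A u v ∧ pdv2 P u v = B u v := by
  let L₁ := ContinuousLinearMap.smulRightL ℝ (ℝ × ℝ) (Fin 3 → ℝ) (ContinuousLinearMap.fst ℝ ℝ ℝ)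
  let L₂ := ContinuousLinearMap.smulRightL ℝ (ℝ × ℝ) (Fin 3 → ℝ) (ContinuousLinearMap.snd ℝ ℝ ℝ)
  let η : ℝ × ℝ → ℝ × ℝ →L[ℝ] (Fin 3 → ℝ) := fun p => L₁ (A p.1 p.2) + L₂ (B p.1 p.2)
  have hη : ContDiffOn ℝ (⊤ : ℕ∞) η D :=
    (L₁.contDiff.comp_contDiffOn hA).add (L₂.contDiff.comp_contDiffOn hB)
  obtain ⟨P, hP⟩ := hD.exists_hasFDerivAt_of_fderiv_symmetric hsc (hη.differentiableOn (by simp))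
    (fun ⟨u, v⟩ ha x y => by
      have hfd : HasFDerivAt η _ (u, v) :=
        (L₁.hasFDerivAt.comp (u, v) (hA.differentiableAt hD ha).hasFDerivAt).add
          (L₂.hasFDerivAt.comp (u, v) (hB.differentiableAt hD ha).hasFDerivAt)
      have key := hAB u v ha
      rw [hA.pdv2_eq_fderiv hD ha, hB.pdv1_eq_fderiv hD ha] at key
      have hdecomp : ∀ (L : ℝ × ℝ →L[ℝ] (Fin 3 → ℝ)) (z : ℝ × ℝ),
          L z = z.1 • L (1, 0) + z.2 • L (0, 1) := fun L z => by
        rw [← map_smul, ← map_smul, ← map_add]; simp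
      rw [hfd.fderiv]
      change y.1 • fderiv ℝ (fun p : ℝ × ℝ => A p.1 p.2) (u, v) x
          + y.2 • fderiv ℝ (fun p : ℝ × ℝ => B p.1 p.2) (u, v) x
        = x.1 • fderiv ℝ (fun p : ℝ × ℝ => A p.1 p.2) (u, v) y
          + x.2 • fderiv ℝ (fun p : ℝ × ℝ => B p.1 p.2) (u, v) y
      rw [hdecomp _ x, hdecomp _ y, hdecomp (fderiv ℝ (fun p : ℝ × ℝ => B p.1 p.2) _) x,
        hdecomp (fderiv ℝ (fun p : ℝ × ℝ => B p.1 p.2) _) y, key]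
      module)
  have hPs : Smooth2 (fun u v => P (u, v)) D :=
    (contDiffOn_infty_iff_fderiv_of_isOpen hD).2
      ⟨fun a ha => (hP a ha).differentiableAt.differentiableWithinAt,
        hη.congr fun a ha => (hP a ha).fderiv⟩
  refine ⟨fun u v => P (u, v), hPs, fun u v h => ?_⟩
  rw [hPs.pdv1_eq_fderiv hD h, hPs.pdv2_eq_fderiv hD h]
  rw [show (fun p : ℝ × ℝ => P (p.1, p.2)) = P from rfl, (hP _ h).fderiv]
  simp [η, L₁, L₂]

theorem Smooth2.smul {c : ℝ → ℝ → ℝ} (hc : Smooth2 c D) (hF : Smooth2 F D) :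
    Smooth2 (fun u v i => c u v * F u v i) D :=
  ContDiffOn.smul hc hF

theorem Smooth2.pdv1_smul {c : ℝ → ℝ → ℝ} {c' : ℝ} (hF : Smooth2 F D) (hD : IsOpen D)
    (h : (u, v) ∈ D) (hc : HasDerivAt (fun x => c x v) c' u) :
    _root_.pdv1 (fun u v i => c u v * F u v i) u v
      = c u v • _root_.pdv1 F u v + c' • F u v :=
  pdv1_eq_of_hasDerivAt (hc.smul (hF.hasDerivAt_pdv1 hD h))

theorem Smooth2.pdv2_smul {c : ℝ → ℝ → ℝ} {c' : ℝ} (hF : Smooth2 F D) (hD : IsOpen D)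
    (h : (u, v) ∈ D) (hc : HasDerivAt (fun y => c u y) c' v) :
    _root_.pdv2 (fun u v i => c u v * F u v i) u v
      = c u v • _root_.pdv2 F u v + c' • F u v :=
  pdv2_eq_of_hasDerivAt (hc.smul (hF.hasDerivAt_pdv2 hD h))

end Partials

section Mink

theorem mink_comm (x y : Fin 3 → ℝ) : mink x y = mink y x := by
  simp only [mink]; ring

theorem mink_add_left (x y z : Fin 3 → ℝ) : mink (x + y) z = mink x z + mink y z := by
  simp only [mink, Pi.add_apply]; ring

theorem mink_smul_left (c : ℝ) (x y : Fin 3 → ℝ) : mink (c • x) y = c * mink x y := by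
  simp only [mink, Pi.smul_apply, smul_eq_mul]; ring

theorem mink_smul_right (c : ℝ) (x y : Fin 3 → ℝ) : mink x (c • y) = c * mink x y := by
  simp only [mink, Pi.smul_apply, smul_eq_mul]; ring

theorem HasDerivAt.mink {a b : ℝ → Fin 3 → ℝ} {a' b' : Fin 3 → ℝ} {t : ℝ}
    (ha : HasDerivAt a a' t) (hb : HasDerivAt b b' t) :
    HasDerivAt (fun s => mink (a s) (b s)) (mink a' (b t) + mink (a t) b') t := by
  rw [hasDerivAt_pi] at ha hb
  refine ((((ha 0).mul (hb 0)).neg.add ((ha 1).mul (hb 1))).add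
    ((ha 2).mul (hb 2))).congr_deriv ?_
  simp only [_root_.mink]; ring

/-- A vector orthogonal to a null frame `(a, b, n)` vanishes. -/
theorem eq_zero_of_mink_frame {a b n x : Fin 3 → ℝ} (haa : mink a a = 0) (hbb : mink b b = 0)
    (hab : mink a b ≠ 0) (hnn : mink n n = 1) (han : mink a n = 0) (hbn : mink b n = 0)
    (hxa : mink x a = 0) (hxb : mink x b = 0) (hxn : mink x n = 0) : x = 0 := by
  let M : Matrix (Fin 3) (Fin 3) ℝ := !![-a 0, a 1, a 2; -b 0, b 1, b 2; -n 0, n 1, n 2]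
  have hdet : M.det ^ 2 = mink a b ^ 2 := by
    have hgram : M.det ^ 2 = -(mink a a * (mink b b * mink n n - mink b n ^ 2)
        - mink a b * (mink a b * mink n n - mink b n * mink a n)
        + mink a n * (mink a b * mink b n - mink b b * mink a n)) := by
      simp only [M, Matrix.det_fin_three, mink, Matrix.of_apply, Matrix.cons_val', Matrix.cons_val]
      ring
    rw [hgram, haa, hbb, hnn, han, hbn]; ring
  refine Matrix.eq_zero_of_mulVec_eq_zero (M := M) (fun h0 => hab ?_) ?_
  · rw [h0] at hdet
    exact pow_eq_zero_iff two_ne_zero |>.1 (by rw [← hdet]; ring)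
  · funext i
    fin_cases i
    · rw [← mink_comm] at hxa
      simpa [M, Matrix.mulVec, dotProduct, Fin.sum_univ_three, mink] using hxa
    · rw [← mink_comm] at hxb
      simpa [M, Matrix.mulVec, dotProduct, Fin.sum_univ_three, mink] using hxb
    · rw [← mink_comm] at hxn
      simpa [M, Matrix.mulVec, dotProduct, Fin.sum_univ_three, mink] using hxn

theorem mink_deriv_self_eq_zero {a : ℝ → Fin 3 → ℝ} {a' : Fin 3 → ℝ} {t : ℝ}
    (ha : HasDerivAt a a' t) (haa : ∀ᶠ s in nhds t, mink (a s) (a s) = 0) :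
    mink a' (a t) = 0 := by
  have h := (ha.mink ha).unique ((hasDerivAt_const t (0 : ℝ)).congr_of_eventuallyEq haa)
  rw [mink_comm (a t)] at h
  linarith

/-- The Gauss formula along a null coordinate line: `a` is the null coordinate field of that line
and `b` the one transverse to it. -/
theorem deriv_null_eq {a b : ℝ → Fin 3 → ℝ} {w : ℝ → ℝ} {a' b' n : Fin 3 → ℝ} {w' t : ℝ}
    (ha : HasDerivAt a a' t) (hb : HasDerivAt b b' t) (hw : HasDerivAt w w' t)
    (haa : ∀ᶠ s in nhds t, mink (a s) (a s) = 0)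
    (hab : ∀ᶠ s in nhds t, mink (a s) (b s) = Real.exp (w s) / 2)
    (hbb : mink (b t) (b t) = 0) (hnn : mink n n = 1) (han : mink (a t) n = 0)
    (hbn : mink (b t) n = 0) (hb' : mink b' (a t) = 0) :
    a' = w' • a t + mink a' n • n := by
  have hconf := (ha.mink hb).unique ((hw.exp.div_const 2).congr_of_eventuallyEq hab)
  rw [mink_comm (a t) b', hb'] at hconf
  have hself := mink_deriv_self_eq_zero ha haa
  have hat := haa.self_of_nhds
  have habt := hab.self_of_nhds
  rw [← sub_eq_zero]
  have hexp : ∀ y, mink (a' - (w' • a t + mink a' n • n)) y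
      = mink a' y - w' * mink (a t) y - mink a' n * mink n y := fun y => by
    simp only [mink, Pi.add_apply, Pi.sub_apply, Pi.smul_apply, smul_eq_mul]; ring
  refine eq_zero_of_mink_frame hat hbb (by rw [habt]; positivity) hnn han hbn ?_ ?_ ?_
  · rw [hexp, mink_comm n, hself, hat, han]; ring
  · rw [hexp, mink_comm n, habt, hbn]; linarith
  · rw [hexp, hnn, han]; ring

end Mink

/-- Proposition 4.14, the Christoffel transformation: a `±`isothermic
conformal timelike immersion `F` in Minkowski 3-space (`Q = (1/2)qϱ(u)`,
`R = ε(1/2)qσ(v)`, `ϱ, σ > 0`) admits on a simply connected domain a dual (Christoffel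
transform) `F*` with `F*_u = e^{−ω}ϱF_v`, `F*_v = εe^{−ω}σF_u`, whose fundamental data
realize `I* = εe^{−ω}ϱσ dudv`, `Q* = ϱH/2`, `R* = εσH/2`, `H* = q`. -/
theorem statement13
    (D : Set (ℝ × ℝ)) (hDopen : IsOpen D) (hDsc : SimplyConnectedSpace ↥D)
    (F N : ℝ → ℝ → Fin 3 → ℝ) (ω : ℝ → ℝ → ℝ)
    (hF : Smooth2 F D) (hNsm : Smooth2 N D) (hω : Smooth2 ω D)
    (hnull1 : ∀ u v, (u, v) ∈ D → mink (pdv1 F u v) (pdv1 F u v) = 0)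
    (hnull2 : ∀ u v, (u, v) ∈ D → mink (pdv2 F u v) (pdv2 F u v) = 0)
    (hconf : ∀ u v, (u, v) ∈ D → mink (pdv1 F u v) (pdv2 F u v) = Real.exp (ω u v) / 2)
    (hNN : ∀ u v, (u, v) ∈ D → mink (N u v) (N u v) = 1)
    (hNFu : ∀ u v, (u, v) ∈ D → mink (pdv1 F u v) (N u v) = 0)
    (hNFv : ∀ u v, (u, v) ∈ D → mink (pdv2 F u v) (N u v) = 0)
    (ε : ℝ) (hε : ε = -1 ∨ ε = 1)
    (ϱ σ : ℝ → ℝ)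
    (hϱ : ContDiff ℝ (⊤ : ℕ∞) ϱ) (hσ : ContDiff ℝ (⊤ : ℕ∞) σ)
    (hϱpos : ∀ x, 0 < ϱ x) (hσpos : ∀ x, 0 < σ x)
    (q : ℝ → ℝ → ℝ) (hq : Smooth2 q D)
    (hQ : ∀ u v, (u, v) ∈ D →
      mink (pdv1 (pdv1 F) u v) (N u v) = (1 / 2) * q u v * ϱ u)
    (hR : ∀ u v, (u, v) ∈ D →
      mink (pdv2 (pdv2 F) u v) (N u v) = ε * ((1 / 2) * q u v * σ v))
    (H : ℝ → ℝ → ℝ)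
    (hH : ∀ u v, H u v = 2 * Real.exp (-ω u v) * mink (pdv2 (pdv1 F) u v) (N u v)) :
    (∀ u v, (u, v) ∈ D → ∀ i,
      pd2 (fun u v => Real.exp (-ω u v) * ϱ u * pdv2 F u v i) u v
        = ε * pd1 (fun u v => Real.exp (-ω u v) * σ v * pdv1 F u v i) u v) ∧
    ∃ Fstar : ℝ → ℝ → Fin 3 → ℝ, Smooth2 Fstar D ∧
      ∀ u v, (u, v) ∈ D →
        (pdv1 Fstar u v = fun i => Real.exp (-ω u v) * ϱ u * pdv2 F u v i) ∧
        (pdv2 Fstar u v = fun i => ε * (Real.exp (-ω u v) * σ v * pdv1 F u v i)) ∧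
        mink (pdv1 Fstar u v) (pdv1 Fstar u v) = 0 ∧
        mink (pdv2 Fstar u v) (pdv2 Fstar u v) = 0 ∧
        mink (pdv1 Fstar u v) (pdv2 Fstar u v) = ε * Real.exp (-ω u v) * ϱ u * σ v / 2 ∧
        mink (pdv1 (pdv1 Fstar) u v) (N u v) = ϱ u * H u v / 2 ∧
        mink (pdv2 (pdv2 Fstar) u v) (N u v) = ε * (σ v * H u v / 2) ∧
        mink (pdv2 (pdv1 Fstar) u v) (N u v)
          = (ε / 2) * q u v * Real.exp (-ω u v) * ϱ u * σ v := by
  have hFu := hF.pdv1 hDopen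
  have hFv := hF.pdv2 hDopen
  let c : ℝ → ℝ → ℝ := fun u v => Real.exp (-ω u v) * ϱ u
  let d : ℝ → ℝ → ℝ := fun u v => ε * (Real.exp (-ω u v) * σ v)
  have hexp : Smooth2 (fun u v => Real.exp (-ω u v)) D := ContDiffOn.exp (ContDiffOn.neg hω)
  have hc : Smooth2 c D := ContDiffOn.mul hexp (hϱ.comp contDiff_fst).contDiffOn
  have hd : Smooth2 d D :=
    ContDiffOn.mul contDiffOn_const (ContDiffOn.mul hexp (hσ.comp contDiff_snd).contDiffOn)
  let A : ℝ → ℝ → Fin 3 → ℝ := fun u v i => c u v * pdv2 F u v i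
  let B : ℝ → ℝ → Fin 3 → ℝ := fun u v i => d u v * pdv1 F u v i
  have hAv : ∀ u v, (u, v) ∈ D →
      pdv2 A u v = (c u v * (ε * ((1 / 2) * q u v * σ v))) • N u v := fun u v h => by
    have hωv := hω.hasDerivAt_snd hDopen h
    have hmem := eventually_snd_mem hDopen h
    have hgauss := deriv_null_eq (hFv.hasDerivAt_pdv2 hDopen h) (hFu.hasDerivAt_pdv2 hDopen h) hωv
      (hmem.mono fun y hy => hnull2 u y hy)
      (hmem.mono fun y hy => by rw [mink_comm, hconf u y hy])
      (hnull1 u v h) (hNN u v h) (hNFv u v h) (hNFu u v h)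
      (by
        rw [hF.pdv2_pdv1 hDopen h]
        exact mink_deriv_self_eq_zero (a := fun x => pdv2 F x v)
          (hFv.hasDerivAt_pdv1 hDopen h)
          ((eventually_fst_mem hDopen h).mono fun x hx => hnull2 x v hx))
    rw [hR u v h] at hgauss
    rw [hFv.pdv2_smul hDopen h (hωv.neg.exp.mul_const (ϱ u)), hgauss]
    module
  have hBu : ∀ u v, (u, v) ∈ D →
      pdv1 B u v = (d u v * ((1 / 2) * q u v * ϱ u)) • N u v := fun u v h => by
    have hωu := hω.hasDerivAt_fst hDopen h
    have hmem := eventually_fst_mem hDopen h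
    have hgauss := deriv_null_eq (hFu.hasDerivAt_pdv1 hDopen h) (hFv.hasDerivAt_pdv1 hDopen h) hωu
      (hmem.mono fun x hx => hnull1 x v hx)
      (hmem.mono fun x hx => hconf x v hx)
      (hnull2 u v h) (hNN u v h) (hNFu u v h) (hNFv u v h)
      (by
        rw [← hF.pdv2_pdv1 hDopen h]
        exact mink_deriv_self_eq_zero (hFu.hasDerivAt_pdv2 hDopen h)
          ((eventually_snd_mem hDopen h).mono fun y hy => hnull1 u y hy))
    rw [hQ u v h] at hgauss
    rw [hFu.pdv1_smul hDopen h ((hωu.neg.exp.mul_const (σ v)).const_mul ε), hgauss]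
    module
  have hAB : ∀ u v, (u, v) ∈ D → pdv2 A u v = pdv1 B u v := fun u v h => by
    rw [hAv u v h, hBu u v h]
    congr 1
    ring
  refine ⟨fun u v h i => ?_, ?_⟩
  · have hB : pdv1 B u v i = ε * pd1 (fun u v => Real.exp (-ω u v) * σ v * pdv1 F u v i) u v := by
      simp only [pd1, _root_.pdv1, B, d, ← deriv_const_mul_field, ← mul_assoc]
    rw [← hB, ← hAB u v h]
    rfl
  obtain ⟨P, hP, hPd⟩ := exists_smooth2_pdv_eq hDopen hDsc (hc.smul hFv) (hd.smul hFu) hAB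
  refine ⟨P, hP, fun u v h => ?_⟩
  have hPu : pdv1 P u v = c u v • pdv2 F u v := (hPd u v h).1
  have hPv : pdv2 P u v = d u v • pdv1 F u v := (hPd u v h).2
  have hPuu : pdv1 (pdv1 P) u v = pdv1 A u v :=
    pdv1_congr hDopen (fun u v h => (hPd u v h).1) h
  have hPvv : pdv2 (pdv2 P) u v = pdv2 B u v :=
    pdv2_congr hDopen (fun u v h => (hPd u v h).2) h
  have hPuv : pdv2 (pdv1 P) u v = pdv2 A u v :=
    pdv2_congr hDopen (fun u v h => (hPd u v h).1) h
  refine ⟨hPu, ?_, ?_, ?_, ?_, ?_, ?_, ?_⟩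
  · rw [hPv]
    funext i
    simp only [d, Pi.smul_apply, smul_eq_mul]
    ring
  · rw [hPu, mink_smul_left, mink_smul_right, hnull2 u v h]; ring
  · rw [hPv, mink_smul_left, mink_smul_right, hnull1 u v h]; ring
  · rw [hPu, hPv, mink_smul_left, mink_smul_right, mink_comm, hconf u v h]
    have hee : Real.exp (-ω u v) * Real.exp (ω u v) = 1 := by rw [← Real.exp_add]; simp
    linear_combination (ε * Real.exp (-ω u v) * ϱ u * σ v / 2) * hee
  · rw [hPuu, hFv.pdv1_smul hDopen h (hc.hasDerivAt_fst hDopen h), mink_add_left, mink_smul_left,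
      mink_smul_left, hNFv u v h, ← hF.pdv2_pdv1 hDopen h, hH]
    ring
  · rw [hPvv, hFu.pdv2_smul hDopen h (hd.hasDerivAt_snd hDopen h), mink_add_left, mink_smul_left,
      mink_smul_left, hNFu u v h, hH]
    ring
  · rw [hPuv, hAv u v h, mink_smul_left, hNN u v h]
    ring
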